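/- arXiv:2006.07640 — 7 statements merged into one kernel-verified Lean document; each statement's English description precedes it below -/
import Mathlib

section
/- Let p₀ < p be positive integers and f : [0,1]^p → ℝ be continuous. Suppose there exist a continuous function f̃ : [0,1]^{p₀} → ℝ and η > 0 such that sup_{x ∈ [0,1]^p} |f(x₁,…,x_p) − f̃(x₁,…,x_{p₀})| < η, and there is a constant τ > 0 such that for each j = 1,…,p₀, |∫_{[0,1]^p} x_j f(x) dx − (1/2)∫_{[0,1]^p} f(x) dx| > τ. Let β_j = 12(∫_{[0,1]^p} x_j f(x) dx − (1/2)∫_{[0,1]^p} f(x) dx) for j = 1,…,p be the BLA coefficients of f. Then |β_j| < 12η for j = p₀+1,…,p, and |β_j| > 12τ for j = 1,…,p₀. -/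
open MeasureTheory

/-- Reflection of the `j`-th coordinate about `1/2` preserves Lebesgue measure. -/
lemma measurePreserving_update_one_sub {ι : Type*} [Fintype ι] [DecidableEq ι] (j : ι) :
    MeasurePreserving (fun x : ι → ℝ => Function.update x j (1 - x j)) := by
  have h := volume_preserving_pi (f := fun i : ι => if i = j then fun t : ℝ => 1 - t else id)
    (fun i => by
      by_cases hi : i = j
      · simpa [hi] using Measure.measurePreserving_sub_left volume (1 : ℝ)
      · simpa [hi] using MeasurePreserving.id (volume : Measure ℝ))
  convert h using 1
  funext x i
  by_cases hi : i = j
  · subst hi; simp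
  · simp [hi]

/-- The integral over the unit cube of `(x j - 1/2) * g x` vanishes when `g` does not depend on
the `j`-th coordinate. -/
lemma setIntegral_cube_sub_half_mul_eq_zero {ι : Type*} [Fintype ι] [DecidableEq ι] (j : ι)
    (g : (ι → ℝ) → ℝ) (hg : ∀ x t, g (Function.update x j t) = g x) :
    ∫ x in Set.univ.pi fun _ : ι => Set.Icc (0 : ℝ) 1, (x j - 1 / 2) * g x = 0 := by
  have hmp := measurePreserving_update_one_sub j
  have hinv : Function.Involutive fun x : ι → ℝ => Function.update x j (1 - x j) := by
    intro x
    simp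
  have hemb := (MeasurableEquiv.ofInvolutive _ hinv hmp.measurable).measurableEmbedding
  have key := hmp.setIntegral_preimage_emb hemb (fun x => (x j - 1 / 2) * g x)
    (Set.univ.pi fun _ : ι => Set.Icc (0 : ℝ) 1)
  have hpre : (fun x : ι → ℝ => Function.update x j (1 - x j)) ⁻¹'
      (Set.univ.pi fun _ : ι => Set.Icc (0 : ℝ) 1) = Set.univ.pi fun _ : ι => Set.Icc (0 : ℝ) 1 := by
    ext x
    simp only [Set.mem_preimage, Set.mem_univ_pi, Set.mem_Icc]
    refine forall_congr' fun i => ?_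
    by_cases hi : i = j
    · subst hi
      simp only [Function.update_self]
      constructor <;> rintro ⟨h₀, h₁⟩ <;> constructor <;> linarith
    · simp [hi]
  have hneg : ∀ x : ι → ℝ, (Function.update x j (1 - x j) j - 1 / 2) *
      g (Function.update x j (1 - x j)) = -((x j - 1 / 2) * g x) := by
    intro x
    rw [hg, Function.update_self]
    ring
  simp only [hpre, hneg] at key
  rw [integral_neg] at key
  linarith

/-- Theorem 1: if `f` is within `η` of a function `f̃` of the first `p₀` variables and the
first `p₀` BLA "signal" quantities exceed `τ`, then the BLA coefficients satisfy
`|β_j| < 12η` for inactive variables and `|β_j| > 12τ` for active ones. -/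
theorem bla_coefficient_bounds (p₀ p : ℕ) (hp₀ : 0 < p₀) (hpp : p₀ < p)
    (f : (Fin p → ℝ) → ℝ) (ftilde : (Fin p₀ → ℝ) → ℝ)
    (cube : Set (Fin p → ℝ))
    (hcube : cube = Set.univ.pi fun _ : Fin p => Set.Icc (0:ℝ) 1)
    (hf : ContinuousOn f cube)
    (hft : ContinuousOn ftilde (Set.univ.pi fun _ : Fin p₀ => Set.Icc (0:ℝ) 1))
    (η : ℝ) (hη : 0 < η)
    (happrox : ∀ x ∈ cube, |f x - ftilde (fun i => x (Fin.castLE hpp.le i))| < η)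
    (τ : ℝ) (hτ : 0 < τ)
    (hactive : ∀ j : Fin p, (j : ℕ) < p₀ →
      τ < |(∫ x in cube, x j * f x) - (1/2) * ∫ x in cube, f x|)
    (β : Fin p → ℝ)
    (hβ : ∀ j, β j = 12 * ((∫ x in cube, x j * f x) - (1/2) * ∫ x in cube, f x)) :
    (∀ j : Fin p, p₀ ≤ (j : ℕ) → |β j| < 12 * η) ∧
    (∀ j : Fin p, (j : ℕ) < p₀ → 12 * τ < |β j|) := by
  subst hcube
  have hactive_bound : ∀ j : Fin p, (j : ℕ) < p₀ → 12 * τ < |β j| := by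
    intro j hj
    rw [hβ, abs_mul, abs_of_pos (by norm_num : (0 : ℝ) < 12)]
    linarith [hactive j hj]
  refine ⟨fun j hj => ?_, hactive_bound⟩
  set Q : Set (Fin p → ℝ) := Set.univ.pi fun _ : Fin p => Set.Icc (0 : ℝ) 1 with hQ
  set g : (Fin p → ℝ) → ℝ := fun x => ftilde fun i => x (Fin.castLE hpp.le i) with hg
  have hQc : IsCompact Q := isCompact_univ_pi fun _ => isCompact_Icc
  have hgc : ContinuousOn g Q :=
    hft.comp (by fun_prop) fun x hx i _ => hx _ (Set.mem_univ _)
  have hxc : ContinuousOn (fun x : Fin p → ℝ => x j) Q := by fun_prop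
  have hg0 : ∫ x in Q, (x j - 1 / 2) * g x = 0 := by
    refine setIntegral_cube_sub_half_mul_eq_zero j g fun x t => ?_
    simp only [hg]
    congr 1
    funext i
    refine Function.update_of_ne (fun h => ?_) _ _
    have := congrArg Fin.val h
    simp only [Fin.val_castLE] at this
    omega
  have hif : IntegrableOn f Q := hf.integrableOn_compact hQc
  have hixf : IntegrableOn (fun x => x j * f x) Q := (hxc.mul hf).integrableOn_compact hQc
  have hig : IntegrableOn (fun x => (x j - 1 / 2) * g x) Q :=
    ((hxc.sub continuousOn_const).mul hgc).integrableOn_compact hQc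
  have heq : (∫ x in Q, x j * f x) - (1 / 2) * ∫ x in Q, f x
      = ∫ x in Q, (x j - 1 / 2) * (f x - g x) := by
    have hsplit : ∀ x : Fin p → ℝ, (x j - 1 / 2) * (f x - g x)
        = x j * f x - 1 / 2 * f x - (x j - 1 / 2) * g x := fun x => by ring
    simp only [hsplit]
    have hdiff : IntegrableOn (fun x => x j * f x - 1 / 2 * f x) Q := hixf.sub (hif.const_mul _)
    rw [integral_sub hdiff hig, integral_sub hixf (hif.const_mul _),
      hg0, integral_const_mul, sub_zero]
  have hvol : volume Q = 1 := by
    rw [hQ, volume_pi_pi]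
    simp
  have hbound : |∫ x in Q, (x j - 1 / 2) * (f x - g x)| ≤ 1 / 2 * η := by
    have h := norm_setIntegral_le_of_norm_le_const (μ := volume) (s := Q) (C := 1 / 2 * η)
      (f := fun x => (x j - 1 / 2) * (f x - g x)) (by simp [hvol]) (fun x hx => by
        have hxj := hx j (Set.mem_univ j)
        rw [Real.norm_eq_abs, abs_mul]
        refine mul_le_mul ?_ (happrox x hx).le (abs_nonneg _) (by norm_num)
        rw [abs_le]
        constructor <;> linarith [hxj.1, hxj.2])
    simpa [Measure.real, hvol] using h
  rw [hβ, heq, abs_mul, abs_of_pos (by norm_num : (0 : ℝ) < 12)]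
  linarith
end

section
/- Let p ≥ 1, let f : [0,1]^p → ℝ be continuous, and let A = {a₁,…,a_m} ⊆ {1,…,p} be a nonempty subset. Then the unique global minimizer over (φ_0, (φ_j)_{j∈A}) ∈ ℝ^{m+1} of ∫_{[0,1]^p} [f(x) − (φ_0 + ∑_{j∈A} φ_j x_j)]^2 dx is given by β(A)_j = 12(∫_{[0,1]^p} x_j f(x) dx − (1/2)∫_{[0,1]^p} f(x) dx) for each j ∈ A, and β_0(A) = ∫_{[0,1]^p} f(x) dx − (1/2)∑_{j∈A} β(A)_j. In particular, the coefficient of x_j in the best linear approximation restricted to the variables in A does not depend on A. -/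
open MeasureTheory

/-- Lebesgue measure on the unit cube is the product of the Lebesgue measures on `[0, 1]`. -/
theorem volume_restrict_unitCube (p : ℕ) :
    (volume : Measure (Fin p → ℝ)).restrict (Set.univ.pi fun _ : Fin p => Set.Icc (0:ℝ) 1) =
      Measure.pi fun _ : Fin p => (volume : Measure ℝ).restrict (Set.Icc (0:ℝ) 1) := by
  rw [volume_pi, Measure.restrict_pi_pi]

theorem integral_Icc_sub_half : ∫ t in Set.Icc (0:ℝ) 1, (t - 1/2) = 0 := by
  rw [integral_Icc_eq_integral_Ioc, ← intervalIntegral.integral_of_le zero_le_one,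
    intervalIntegral.integral_sub (by simp) (by simp)]
  simp

theorem integral_Icc_sub_half_sq :
    ∫ t in Set.Icc (0:ℝ) 1, (t - 1/2) * (t - 1/2) = 1/12 := by
  rw [integral_Icc_eq_integral_Ioc, ← intervalIntegral.integral_of_le zero_le_one]
  simp only [← pow_two]
  rw [intervalIntegral.integral_comp_sub_right (fun t : ℝ => t ^ 2), integral_pow]
  norm_num

/-- The centered coordinates have mean zero on the unit cube. -/
theorem integral_unitCube_centered {p : ℕ} (i : Fin p) :
    ∫ x in Set.univ.pi fun _ : Fin p => Set.Icc (0:ℝ) 1, (x i - 1/2) = 0 := by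
  have h := integral_fintype_prod_eq_prod (𝕜 := ℝ)
    (fun (k : Fin p) (t : ℝ) => if k = i then t - 1/2 else 1)
    (μ := fun _ => (volume : Measure ℝ).restrict (Set.Icc (0:ℝ) 1))
  rw [← volume_restrict_unitCube] at h
  simp only [Finset.prod_ite_eq', Finset.mem_univ, if_true] at h
  rw [h]
  refine Finset.prod_eq_zero (Finset.mem_univ i) ?_
  simpa using integral_Icc_sub_half

/-- The centered coordinates are orthogonal on the unit cube, with variance `1/12`. -/
theorem integral_unitCube_centered_mul {p : ℕ} (i j : Fin p) :
    ∫ x in Set.univ.pi fun _ : Fin p => Set.Icc (0:ℝ) 1, (x i - 1/2) * (x j - 1/2) =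
      if i = j then 1/12 else 0 := by
  have h := integral_fintype_prod_eq_prod (𝕜 := ℝ)
    (fun (k : Fin p) (t : ℝ) => (if k = i then t - 1/2 else 1) * (if k = j then t - 1/2 else 1))
    (μ := fun _ => (volume : Measure ℝ).restrict (Set.Icc (0:ℝ) 1))
  rw [← volume_restrict_unitCube] at h
  simp only [Finset.prod_mul_distrib, Finset.prod_ite_eq', Finset.mem_univ, if_true] at h
  rw [h]
  split_ifs with hij
  · subst hij
    rw [Finset.prod_eq_single i]
    · simpa using integral_Icc_sub_half_sq
    · intro k _ hk
      simp [hk]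
    · simp
  · refine Finset.prod_eq_zero (Finset.mem_univ i) ?_
    simpa [hij] using integral_Icc_sub_half

/-- Lemma 6 (formula part): for a nonempty subset `A` of variables, the unique minimizer of
the squared `L²` loss over affine functions of the variables in `A` is given by
`β(A)_j = 12(∫ x_j f − ½∫ f)` for `j ∈ A` and
`β₀(A) = ∫ f − ½ ∑_{j∈A} β(A)_j`; in particular the coefficient of `x_j` does not
depend on `A`. -/
theorem bla_subset_formula (p : ℕ) (hp : 1 ≤ p) (f : (Fin p → ℝ) → ℝ)
    (cube : Set (Fin p → ℝ))
    (hcube : cube = Set.univ.pi fun _ : Fin p => Set.Icc (0:ℝ) 1)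
    (hf : ContinuousOn f cube)
    (A : Finset (Fin p)) (hA : A.Nonempty)
    (β : Fin p → ℝ)
    (hβ : ∀ j, β j = 12 * ((∫ x in cube, x j * f x) - (1/2) * ∫ x in cube, f x))
    (β₀A : ℝ) (hβ₀A : β₀A = (∫ x in cube, f x) - (1/2) * ∑ j ∈ A, β j)
    (G : ℝ → (Fin p → ℝ) → ℝ)
    (hG : ∀ φ₀ φ, G φ₀ φ = ∫ x in cube, (f x - (φ₀ + ∑ j ∈ A, φ j * x j))^2) :
    ∀ φ₀ φ, (φ₀ ≠ β₀A ∨ ∃ j ∈ A, φ j ≠ β j) → G β₀A β < G φ₀ φ := by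
  intro φ₀ φ hne
  have hcompact : IsCompact cube := hcube ▸ isCompact_univ_pi fun _ => isCompact_Icc
  have hint : ∀ {g : (Fin p → ℝ) → ℝ}, ContinuousOn g cube → IntegrableOn g cube :=
    fun hg => hg.integrableOn_compact hcompact
  have hone : ∫ _ in cube, (1:ℝ) = 1 := by
    rw [hcube, volume_restrict_unitCube]
    simp [Measure.real, Measure.pi_univ]
  have hmean (i : Fin p) : ∫ x in cube, (x i - 1/2) = 0 :=
    hcube ▸ integral_unitCube_centered i
  have hcov (i j : Fin p) :
      ∫ x in cube, (x i - 1/2) * (x j - 1/2) = if i = j then 1/12 else 0 :=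
    hcube ▸ integral_unitCube_centered_mul i j
  have hconst (c : ℝ) : ∫ _ in cube, c = c := by
    simpa [hone] using integral_const_mul (μ := volume.restrict cube) c (fun _ => (1:ℝ))
  -- the integral of a function against an affine function in centered coordinates
  have haff (g : (Fin p → ℝ) → ℝ) (hg : ContinuousOn g cube) (c : ℝ) (δ : Fin p → ℝ) :
      ∫ x in cube, g x * (c + ∑ j ∈ A, δ j * (x j - 1/2)) =
        c * (∫ x in cube, g x) + ∑ j ∈ A, δ j * ∫ x in cube, g x * (x j - 1/2) := by
    have hterm (j : Fin p) : IntegrableOn (fun x => δ j * (g x * (x j - 1/2))) cube :=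
      hint (by fun_prop)
    calc ∫ x in cube, g x * (c + ∑ j ∈ A, δ j * (x j - 1/2))
        = ∫ x in cube, (c * g x + ∑ j ∈ A, δ j * (g x * (x j - 1/2))) := by
          congr 1; ext x
          rw [mul_add, Finset.mul_sum, mul_comm]
          congr 1
          exact Finset.sum_congr rfl fun j _ => by ring
      _ = _ := by
          rw [integral_add (hint (by fun_prop)) (integrable_finsetSum _ fun j _ => hterm j),
            integral_finsetSum _ fun j _ => hterm j]
          simp only [integral_const_mul]
  have haff_mean (c : ℝ) (δ : Fin p → ℝ) :
      ∫ x in cube, (c + ∑ j ∈ A, δ j * (x j - 1/2)) = c := by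
    have h := haff (fun _ => 1) (by fun_prop) c δ
    simpa only [one_mul, hone, hmean, mul_one, mul_zero, Finset.sum_const_zero, add_zero] using h
  have haff_coord (c : ℝ) (δ : Fin p → ℝ) (k : Fin p) (hk : k ∈ A) :
      ∫ x in cube, (c + ∑ j ∈ A, δ j * (x j - 1/2)) * (x k - 1/2) = δ k / 12 := by
    have h := haff (fun x => x k - 1/2) (by fun_prop) c δ
    simp only [hmean, hcov] at h
    simp_rw [mul_comm _ ((_ : ℝ) - 1/2)] at h ⊢
    rw [h]
    simp [hk]
    ring
  have hfcoord (k : Fin p) : ∫ x in cube, f x * (x k - 1/2) = β k / 12 := by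
    have : ∀ x : Fin p → ℝ, f x * (x k - 1/2) = x k * f x - (1/2) * f x := fun x => by ring
    simp only [this]
    rw [integral_sub (hint (by fun_prop)) (hint (by fun_prop)), integral_const_mul, hβ]
    ring
  set b : ℝ := ∫ x in cube, f x with hb
  let r : (Fin p → ℝ) → ℝ := fun x => f x - (b + ∑ j ∈ A, β j * (x j - 1/2))
  have hr : ContinuousOn r cube := by fun_prop
  have hr_mean : ∫ x in cube, r x = 0 := by
    rw [integral_sub (hint hf) (hint (by fun_prop)), haff_mean, ← hb, sub_self]
  have hr_coord (k : Fin p) (hk : k ∈ A) : ∫ x in cube, r x * (x k - 1/2) = 0 := by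
    simp only [r, sub_mul _ _ ((_ : ℝ) - 1/2)]
    rw [integral_sub (hint (by fun_prop)) (hint (by fun_prop)), hfcoord, haff_coord _ _ _ hk,
      sub_self]
  let δ : Fin p → ℝ := fun j => φ j - β j
  let c : ℝ := φ₀ + (1/2) * ∑ j ∈ A, φ j - b
  let d : (Fin p → ℝ) → ℝ := fun x => c + ∑ j ∈ A, δ j * (x j - 1/2)
  have hd : ContinuousOn d cube := by fun_prop
  have hrd : ∫ x in cube, r x * d x = 0 := by
    rw [haff r hr, hr_mean, Finset.sum_eq_zero fun j hj => by rw [hr_coord j hj, mul_zero]]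
    simp
  have hdd : ∫ x in cube, d x * d x = c ^ 2 + ∑ j ∈ A, δ j ^ 2 / 12 := by
    rw [haff d hd, haff_mean, pow_two]
    congr 1
    exact Finset.sum_congr rfl fun j hj => by rw [haff_coord _ _ _ hj]; ring
  have hGβ : G β₀A β = ∫ x in cube, r x ^ 2 := by
    rw [hG]
    congr 1; ext x
    simp only [r, hβ₀A, mul_sub, Finset.sum_sub_distrib, ← Finset.sum_mul]
    ring
  have hGφ : G φ₀ φ = (∫ x in cube, r x ^ 2) + (c ^ 2 + ∑ j ∈ A, δ j ^ 2 / 12) := by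
    have hx (x : Fin p → ℝ) :
        (f x - (φ₀ + ∑ j ∈ A, φ j * x j)) ^ 2 = r x ^ 2 - 2 * (r x * d x) + d x * d x := by
      simp only [r, d, c, δ, mul_sub, sub_mul, Finset.sum_sub_distrib, ← Finset.sum_mul]
      ring
    rw [hG]
    simp only [hx]
    rw [integral_add (hint (by fun_prop)) (hint (by fun_prop)),
      integral_sub (hint (by fun_prop)) (hint (by fun_prop)), integral_const_mul, hrd, hdd]
    ring
  rw [hGβ, hGφ, lt_add_iff_pos_right]
  have hsum : 0 ≤ ∑ j ∈ A, δ j ^ 2 / 12 := Finset.sum_nonneg fun j _ => by positivity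
  by_cases hφ : ∃ j ∈ A, φ j ≠ β j
  · obtain ⟨j, hj, hjne⟩ := hφ
    have hδ : δ j ≠ 0 := sub_ne_zero.mpr hjne
    have : 0 < ∑ j ∈ A, δ j ^ 2 / 12 :=
      Finset.sum_pos' (fun j _ => by positivity) ⟨j, hj, by positivity⟩
    positivity
  · have hφ₀ := hne.resolve_right hφ
    push Not at hφ
    have hc : c ≠ 0 := by
      intro hc
      apply hφ₀
      simp only [c, Finset.sum_congr rfl hφ] at hc
      linarith
    positivity
end

section
/- Let p₀ < p be positive integers with p₀ ≤ M, and let f : [0,1]^p → ℝ be continuous. Suppose there exist a continuous f̃ : [0,1]^{p₀} → ℝ and η > 0 with sup_{x ∈ [0,1]^p}|f(x₁,…,x_p) − f̃(x₁,…,x_{p₀})| < η, and τ > 0 such that |∫_{[0,1]^p} x_j f(x) dx − (1/2)∫_{[0,1]^p} f(x) dx| > τ for each j = 1,…,p₀. Set A₀ = {1,…,p₀}, and let A₁ ⊆ {1,…,p} be any subset with |A₁| = M and A₀ \ A₁ ≠ ∅. Then, denoting by L(A) the BLA loss of f restricted to the variables in A, we have L(A₁) − L(A₀) ≥ 12τ²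 − 12(M − p₀ + 1)η². -/
open MeasureTheory

/-- The uniform probability measure on the unit cube. -/
noncomputable def unitCubeMeasure (p : ℕ) : Measure (Fin p → ℝ) :=
  Measure.pi fun _ : Fin p => (volume : Measure ℝ).restrict (Set.Icc 0 1)

instance isProbabilityMeasure_restrict_Icc_zero_one :
    IsProbabilityMeasure ((volume : Measure ℝ).restrict (Set.Icc 0 1)) :=
  ⟨by simp⟩

instance isProbabilityMeasure_unitCubeMeasure (p : ℕ) :
    IsProbabilityMeasure (unitCubeMeasure p) := by
  unfold unitCubeMeasure; infer_instance

theorem volume_restrict_unit_cube (p : ℕ) :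
    (volume : Measure (Fin p → ℝ)).restrict (Set.univ.pi fun _ : Fin p => Set.Icc (0:ℝ) 1)
      = unitCubeMeasure p := by
  rw [volume_pi, Measure.restrict_pi_pi]; rfl

theorem measurePreserving_one_sub_Icc :
    MeasurePreserving (fun t : ℝ => 1 - t) (volume.restrict (Set.Icc 0 1))
      (volume.restrict (Set.Icc 0 1)) := by
  have h := (Measure.measurePreserving_sub_left (volume : Measure ℝ) 1).restrict_preimage
    (measurableSet_Icc (a := (0:ℝ)) (b := 1))
  simpa using h

theorem measurePreserving_reflect {p : ℕ} (j : Fin p) :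
    MeasurePreserving (fun x : Fin p → ℝ => Function.update x j (1 - x j))
      (unitCubeMeasure p) (unitCubeMeasure p) := by
  have h := measurePreserving_pi
    (fun _ : Fin p => (volume : Measure ℝ).restrict (Set.Icc 0 1))
    (fun _ : Fin p => (volume : Measure ℝ).restrict (Set.Icc 0 1))
    (f := fun i t => if i = j then 1 - t else t)
    (fun i => by
      by_cases hij : i = j
      · simpa [hij] using measurePreserving_one_sub_Icc
      · simpa [hij, Function.id_def] using MeasurePreserving.id (volume.restrict (Set.Icc (0:ℝ) 1)))
  unfold unitCubeMeasure
  convert h using 1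
  ext x i
  by_cases hij : i = j
  · subst hij; simp
  · simp [hij]

theorem integral_eq_zero_of_reflect_neg {p : ℕ} (j : Fin p) {F : (Fin p → ℝ) → ℝ}
    (hF : AEStronglyMeasurable F (unitCubeMeasure p))
    (hodd : ∀ x, F (Function.update x j (1 - x j)) = -F x) :
    ∫ x, F x ∂unitCubeMeasure p = 0 := by
  have hT := measurePreserving_reflect j
  have h := integral_map (μ := unitCubeMeasure p) hT.measurable.aemeasurable
    (f := F) (by rwa [hT.map_eq])
  rw [hT.map_eq] at h
  simp only [hodd, integral_neg] at h
  linarith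

theorem integral_centered_sq {p : ℕ} (j : Fin p) :
    ∫ x, (x j - 1/2) * (x j - 1/2) ∂unitCubeMeasure p = 1/12 := by
  have hT := measurePreserving_eval
    (fun _ : Fin p => (volume : Measure ℝ).restrict (Set.Icc 0 1)) j
  have h := integral_map (μ := unitCubeMeasure p) hT.measurable.aemeasurable
    (f := fun t : ℝ => (t - 1/2) * (t - 1/2)) (by fun_prop)
  rw [unitCubeMeasure, hT.map_eq] at h
  rw [unitCubeMeasure]
  refine h.symm.trans ?_
  rw [integral_Icc_eq_integral_Ioc, ← intervalIntegral.integral_of_le zero_le_one]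
  have e : ∀ t : ℝ, (t - 1/2) * (t - 1/2) = (fun s : ℝ => s ^ 2) (t - 1/2) := fun t => by ring
  simp only [e, intervalIntegral.integral_comp_sub_right (fun s : ℝ => s ^ 2), integral_pow]
  norm_num

theorem integral_centered_mul_centered {p : ℕ} (i j : Fin p) :
    ∫ x, (x i - 1/2) * (x j - 1/2) ∂unitCubeMeasure p = if i = j then 1/12 else 0 := by
  split_ifs with h
  · subst h; exact integral_centered_sq i
  · refine integral_eq_zero_of_reflect_neg i (by fun_prop) fun x => ?_
    rw [Function.update_self, Function.update_of_ne (Ne.symm h)]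
    ring

theorem integral_centered {p : ℕ} (j : Fin p) :
    ∫ x, (x j - 1/2) ∂unitCubeMeasure p = 0 := by
  refine integral_eq_zero_of_reflect_neg j
    (by fun_prop : Measurable fun x : Fin p → ℝ => x j - 1/2).aestronglyMeasurable fun x => ?_
  rw [Function.update_self]
  ring

theorem ContinuousOn.memLp_two_unitCubeMeasure {p : ℕ} {g : (Fin p → ℝ) → ℝ}
    (hg : ContinuousOn g (Set.univ.pi fun _ : Fin p => Set.Icc (0:ℝ) 1)) :
    MemLp g 2 (unitCubeMeasure p) := by
  have hK : IsCompact (Set.univ.pi fun _ : Fin p => Set.Icc (0:ℝ) 1) :=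
    isCompact_univ_pi fun _ => isCompact_Icc
  obtain ⟨C, hC⟩ := hK.exists_bound_of_continuousOn hg
  have hm := hK.measurableSet
  refine MemLp.of_bound ?_ C ?_
  · rw [← volume_restrict_unit_cube]
    exact hg.aestronglyMeasurable hm
  · rw [← volume_restrict_unit_cube]
    exact (ae_restrict_iff' hm).2 (Filter.Eventually.of_forall hC)

theorem memLp_two_centered {p : ℕ} (j : Fin p) :
    MemLp (fun x : Fin p → ℝ => x j - 1/2) 2 (unitCubeMeasure p) :=
  ContinuousOn.memLp_two_unitCubeMeasure (by fun_prop)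

theorem integral_sub_sum_centered_sq {p : ℕ} {h : (Fin p → ℝ) → ℝ}
    (hh : MemLp h 2 (unitCubeMeasure p)) (A : Finset (Fin p)) (b : Fin p → ℝ) :
    ∫ x, (h x - ∑ j ∈ A, b j * (x j - 1/2)) ^ 2 ∂unitCubeMeasure p
      = ∫ x, h x ^ 2 ∂unitCubeMeasure p
        - 2 * ∑ j ∈ A, b j * ∫ x, h x * (x j - 1/2) ∂unitCubeMeasure p
        + 1/12 * ∑ j ∈ A, b j ^ 2 := by
  have hhu : ∀ j : Fin p, Integrable (fun x => h x * (x j - 1/2)) (unitCubeMeasure p) :=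
    fun j => hh.integrable_mul (memLp_two_centered j)
  have huu : ∀ i j : Fin p,
      Integrable (fun x : Fin p → ℝ => (x i - 1/2) * (x j - 1/2)) (unitCubeMeasure p) :=
    fun i j => (memLp_two_centered i).integrable_mul (memLp_two_centered j)
  have e : ∀ x : Fin p → ℝ, (h x - ∑ j ∈ A, b j * (x j - 1/2)) ^ 2
      = h x ^ 2 - 2 * ∑ j ∈ A, b j * (h x * (x j - 1/2))
        + ∑ i ∈ A, ∑ j ∈ A, (b i * b j) * ((x i - 1/2) * (x j - 1/2)) := fun x => by
    have e₁ : ∑ j ∈ A, b j * (h x * (x j - 1/2)) = h x * ∑ j ∈ A, b j * (x j - 1/2) := by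
      rw [Finset.mul_sum]; exact Finset.sum_congr rfl fun j _ => by ring
    have e₂ : ∑ i ∈ A, ∑ j ∈ A, (b i * b j) * ((x i - 1/2) * (x j - 1/2))
        = (∑ j ∈ A, b j * (x j - 1/2)) * ∑ j ∈ A, b j * (x j - 1/2) := by
      rw [Finset.sum_mul_sum]
      exact Finset.sum_congr rfl fun i _ => Finset.sum_congr rfl fun j _ => by ring
    rw [e₁, e₂]; ring
  have i₁ : Integrable (fun x => 2 * ∑ j ∈ A, b j * (h x * (x j - 1/2))) (unitCubeMeasure p) :=
    (integrable_finsetSum _ fun j _ => (hhu j).const_mul _).const_mul _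
  have i₂ : Integrable (fun x : Fin p → ℝ =>
      ∑ i ∈ A, ∑ j ∈ A, (b i * b j) * ((x i - 1/2) * (x j - 1/2))) (unitCubeMeasure p) :=
    integrable_finsetSum _ fun i _ => integrable_finsetSum _ fun j _ => (huu i j).const_mul _
  have i₃ : Integrable (fun x => h x ^ 2 - 2 * ∑ j ∈ A, b j * (h x * (x j - 1/2)))
      (unitCubeMeasure p) := hh.integrable_sq.sub i₁
  simp only [e]
  rw [integral_add i₃ i₂, integral_sub hh.integrable_sq i₁,
    integral_const_mul, integral_finsetSum _ fun j _ => (hhu j).const_mul _,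
    integral_finsetSum _ fun i _ => integrable_finsetSum _ fun j _ => (huu i j).const_mul _]
  congr 1
  · simp only [integral_const_mul]
  · rw [Finset.mul_sum]
    refine Finset.sum_congr rfl fun i hi => ?_
    rw [integral_finsetSum _ fun j _ => (huu i j).const_mul _]
    simp only [integral_const_mul, integral_centered_mul_centered, mul_ite, mul_zero,
      Finset.sum_ite_eq, hi, if_true]
    ring

/-- Bessel's inequality for the centered coordinates on the unit cube. -/
theorem sum_sq_integral_mul_centered_le {p : ℕ} {h : (Fin p → ℝ) → ℝ}
    (hh : MemLp h 2 (unitCubeMeasure p)) (A : Finset (Fin p)) :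
    12 * ∑ j ∈ A, (∫ x, h x * (x j - 1/2) ∂unitCubeMeasure p) ^ 2
      ≤ ∫ x, h x ^ 2 ∂unitCubeMeasure p := by
  have e := integral_sub_sum_centered_sq hh A
    fun j => 12 * ∫ x, h x * (x j - 1/2) ∂unitCubeMeasure p
  have hpos : 0 ≤ ∫ x, (h x - ∑ j ∈ A, (12 * ∫ y, h y * (y j - 1/2) ∂unitCubeMeasure p)
      * (x j - 1/2)) ^ 2 ∂unitCubeMeasure p := integral_nonneg fun x => sq_nonneg _
  simp only [mul_assoc, mul_pow, ← pow_two, ← Finset.mul_sum] at e hpos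
  linarith

theorem integral_sub_affine_sq {p : ℕ} {g : (Fin p → ℝ) → ℝ}
    (hg : MemLp g 2 (unitCubeMeasure p)) (A : Finset (Fin p)) (a : ℝ) (b : Fin p → ℝ) :
    ∫ x, (g x - (a + ∑ j ∈ A, b j * x j)) ^ 2 ∂unitCubeMeasure p
      = ∫ x, g x ^ 2 ∂unitCubeMeasure p - (∫ x, g x ∂unitCubeMeasure p) ^ 2
        - 12 * ∑ j ∈ A, (∫ x, g x * (x j - 1/2) ∂unitCubeMeasure p) ^ 2
        + (a + (∑ j ∈ A, b j) / 2 - ∫ x, g x ∂unitCubeMeasure p) ^ 2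
        + 1/12 * ∑ j ∈ A, (b j - 12 * ∫ x, g x * (x j - 1/2) ∂unitCubeMeasure p) ^ 2 := by
  set c := a + (∑ j ∈ A, b j) / 2 with hc
  have hgi : Integrable g (unitCubeMeasure p) := hg.integrable one_le_two
  have hmem : MemLp (fun x => g x - c) 2 (unitCubeMeasure p) := hg.sub (memLp_const c)
  have e : ∀ x : Fin p → ℝ, g x - (a + ∑ j ∈ A, b j * x j)
      = g x - c - ∑ j ∈ A, b j * (x j - 1/2) := fun x => by
    simp only [mul_sub, Finset.sum_sub_distrib, ← Finset.sum_mul, hc]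
    ring
  have hcoef : ∀ j : Fin p, ∫ x, (g x - c) * (x j - 1/2) ∂unitCubeMeasure p
      = ∫ x, g x * (x j - 1/2) ∂unitCubeMeasure p := fun j => by
    have hu : Integrable (fun x : Fin p → ℝ => x j - 1/2) (unitCubeMeasure p) :=
      (memLp_two_centered j).integrable one_le_two
    have hgu : Integrable (fun x => g x * (x j - 1/2)) (unitCubeMeasure p) :=
      hg.integrable_mul (memLp_two_centered j)
    simp only [sub_mul (g _) c]
    rw [integral_sub hgu (hu.const_mul c), integral_const_mul, integral_centered]
    ring
  have hsq : ∫ x, (g x - c) ^ 2 ∂unitCubeMeasure p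
      = ∫ x, g x ^ 2 ∂unitCubeMeasure p - 2 * c * ∫ x, g x ∂unitCubeMeasure p + c ^ 2 := by
    have e₁ : ∀ x, (g x - c) ^ 2 = g x ^ 2 - 2 * c * g x + c ^ 2 := fun x => by ring
    have i₁ : Integrable (fun x => g x ^ 2 - 2 * c * g x) (unitCubeMeasure p) :=
      hg.integrable_sq.sub (hgi.const_mul _)
    simp only [e₁]
    rw [integral_add i₁ (integrable_const _),
      integral_sub hg.integrable_sq (hgi.const_mul _), integral_const_mul]
    simp
  simp only [e]
  rw [integral_sub_sum_centered_sq hmem, hsq]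
  simp only [hcoef]
  have e₂ : ∑ j ∈ A, (b j - 12 * ∫ x, g x * (x j - 1/2) ∂unitCubeMeasure p) ^ 2
      = ∑ j ∈ A, b j ^ 2 - 24 * ∑ j ∈ A, b j * ∫ x, g x * (x j - 1/2) ∂unitCubeMeasure p
        + 144 * ∑ j ∈ A, (∫ x, g x * (x j - 1/2) ∂unitCubeMeasure p) ^ 2 := by
    rw [Finset.mul_sum, Finset.mul_sum, ← Finset.sum_sub_distrib, ← Finset.sum_add_distrib]
    exact Finset.sum_congr rfl fun j _ => by ring
  rw [e₂]
  ring

theorem iInf_integral_sub_affine_sq {p : ℕ} {g : (Fin p → ℝ) → ℝ}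
    (hg : MemLp g 2 (unitCubeMeasure p)) (A : Finset (Fin p)) :
    ⨅ a : ℝ, ⨅ b : Fin p → ℝ,
        ∫ x, (g x - (a + ∑ j ∈ A, b j * x j)) ^ 2 ∂unitCubeMeasure p
      = ∫ x, g x ^ 2 ∂unitCubeMeasure p - (∫ x, g x ∂unitCubeMeasure p) ^ 2
        - 12 * ∑ j ∈ A, (∫ x, g x * (x j - 1/2) ∂unitCubeMeasure p) ^ 2 := by
  have hnn : ∀ (a : ℝ) (b : Fin p → ℝ),
      0 ≤ ∫ x, (g x - (a + ∑ j ∈ A, b j * x j)) ^ 2 ∂unitCubeMeasure p :=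
    fun a b => integral_nonneg fun x => sq_nonneg _
  apply le_antisymm
  · set b : Fin p → ℝ := fun j => 12 * ∫ x, g x * (x j - 1/2) ∂unitCubeMeasure p with hb
    set a : ℝ := ∫ x, g x ∂unitCubeMeasure p - (∑ j ∈ A, b j) / 2 with ha
    refine (ciInf_le ⟨0, Set.forall_mem_range.2 fun a => Real.iInf_nonneg (hnn a)⟩ a).trans ?_
    refine (ciInf_le ⟨0, Set.forall_mem_range.2 (hnn a)⟩ b).trans ?_
    rw [integral_sub_affine_sq hg]
    simp [ha, hb]
  · refine le_ciInf fun a => le_ciInf fun b => ?_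
    rw [integral_sub_affine_sq hg]
    have h : 0 ≤ ∑ j ∈ A, (b j - 12 * ∫ x, g x * (x j - 1/2) ∂unitCubeMeasure p) ^ 2 :=
      Finset.sum_nonneg fun j _ => sq_nonneg _
    have h' := sq_nonneg (a + (∑ j ∈ A, b j) / 2 - ∫ x, g x ∂unitCubeMeasure p)
    linarith

/-- Lemma 7 (lemma a0): under the near-sparsity assumption, any size-`M` variable subset
`A₁` missing an active variable has BLA loss exceeding that of the true subset
`A₀ = {1,…,p₀}` by at least `12τ² − 12(M − p₀ + 1)η²`. -/
theorem bla_loss_gap (p₀ p M : ℕ) (hp₀ : 0 < p₀) (hpp : p₀ < p) (hp₀M : p₀ ≤ M)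
    (f : (Fin p → ℝ) → ℝ) (ftilde : (Fin p₀ → ℝ) → ℝ)
    (cube : Set (Fin p → ℝ))
    (hcube : cube = Set.univ.pi fun _ : Fin p => Set.Icc (0:ℝ) 1)
    (hf : ContinuousOn f cube)
    (hft : ContinuousOn ftilde (Set.univ.pi fun _ : Fin p₀ => Set.Icc (0:ℝ) 1))
    (η : ℝ) (hη : 0 < η)
    (happrox : ∀ x ∈ cube, |f x - ftilde (fun i => x (Fin.castLE hpp.le i))| < η)
    (τ : ℝ) (hτ : 0 < τ)
    (hactive : ∀ j : Fin p, (j : ℕ) < p₀ →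
      τ < |(∫ x in cube, x j * f x) - (1/2) * ∫ x in cube, f x|)
    (L : Finset (Fin p) → ℝ)
    (hL : ∀ A, L A = ⨅ φ₀ : ℝ, ⨅ φ : Fin p → ℝ,
      ∫ x in cube, (f x - (φ₀ + ∑ j ∈ A, φ j * x j))^2)
    (A₀ : Finset (Fin p)) (hA₀ : A₀ = Finset.univ.filter fun j : Fin p => (j : ℕ) < p₀)
    (A₁ : Finset (Fin p)) (hcard : A₁.card = M) (hmiss : (A₀ \ A₁).Nonempty) :
    12 * τ^2 - 12 * ((M : ℝ) - (p₀ : ℝ) + 1) * η^2 ≤ L A₁ - L A₀ := by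
  subst hcube hA₀
  have hK : IsCompact (Set.univ.pi fun _ : Fin p => Set.Icc (0:ℝ) 1) :=
    isCompact_univ_pi fun _ => isCompact_Icc
  have hproj : ContinuousOn (fun x : Fin p → ℝ => ftilde fun i => x (Fin.castLE hpp.le i))
      (Set.univ.pi fun _ : Fin p => Set.Icc (0:ℝ) 1) :=
    hft.comp (by fun_prop) fun x hx i _ => hx _ (Set.mem_univ _)
  have hfm := hf.memLp_two_unitCubeMeasure
  have htm := hproj.memLp_two_unitCubeMeasure
  have hdm : MemLp (fun x => f x - ftilde fun i => x (Fin.castLE hpp.le i)) 2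
      (unitCubeMeasure p) := (hf.sub hproj).memLp_two_unitCubeMeasure
  simp only [volume_restrict_unit_cube] at hactive hL
  have hbound : ∫ x, (f x - ftilde fun i => x (Fin.castLE hpp.le i)) ^ 2 ∂unitCubeMeasure p
      ≤ η ^ 2 := by
    have hae : ∀ᵐ x ∂unitCubeMeasure p,
        (f x - ftilde fun i => x (Fin.castLE hpp.le i)) ^ 2 ≤ η ^ 2 := by
      rw [← volume_restrict_unit_cube]
      refine (ae_restrict_iff' hK.measurableSet).2 (Filter.Eventually.of_forall fun x hx => ?_)
      exact sq_le_sq' (abs_lt.1 (happrox x hx)).1.le (abs_lt.1 (happrox x hx)).2.le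
    simpa using integral_mono_ae hdm.integrable_sq (integrable_const (η ^ 2)) hae
  set c : Fin p → ℝ := fun j => ∫ x, f x * (x j - 1/2) ∂unitCubeMeasure p
  have hcoef : ∀ j : Fin p, p₀ ≤ (j : ℕ) →
      ∫ x, (f x - ftilde fun i => x (Fin.castLE hpp.le i)) * (x j - 1/2) ∂unitCubeMeasure p
        = c j := fun j hj => by
    have hfu : Integrable (fun x => f x * (x j - 1/2)) (unitCubeMeasure p) :=
      hfm.integrable_mul (memLp_two_centered j)
    have htu : Integrable (fun x : Fin p → ℝ =>
        (ftilde fun i => x (Fin.castLE hpp.le i)) * (x j - 1/2)) (unitCubeMeasure p) :=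
      htm.integrable_mul (memLp_two_centered j)
    have hzero : ∫ x : Fin p → ℝ, (ftilde fun i => x (Fin.castLE hpp.le i)) * (x j - 1/2)
        ∂unitCubeMeasure p = 0 := by
      refine integral_eq_zero_of_reflect_neg j htu.aestronglyMeasurable fun x => ?_
      have hne : ∀ i : Fin p₀, Fin.castLE hpp.le i ≠ j := fun i h => by
        have := congrArg Fin.val h
        have := i.isLt
        simp at *
        omega
      simp only [Function.update_self, Function.update_of_ne (hne _)]
      ring
    simp only [sub_mul (f _)]
    rw [integral_sub hfu htu, hzero, sub_zero]
  have hlarge : ∀ j : Fin p, (j : ℕ) < p₀ → τ ^ 2 ≤ c j ^ 2 := fun j hj => by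
    have hfu : Integrable (fun x => x j * f x) (unitCubeMeasure p) := by
      have h : ContinuousOn (fun x : Fin p → ℝ => x j * f x) _ :=
        (continuous_apply j).continuousOn.mul hf
      exact h.memLp_two_unitCubeMeasure.integrable one_le_two
    have e : c j = ∫ x, x j * f x ∂unitCubeMeasure p - 1/2 * ∫ x, f x ∂unitCubeMeasure p := by
      rw [← integral_const_mul, ← integral_sub hfu ((hfm.integrable one_le_two).const_mul _)]
      exact integral_congr_ae (Filter.Eventually.of_forall fun x => by ring)
    rw [sq_le_sq, abs_of_pos hτ, e]
    exact (hactive j hj).le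
  set A₀ := Finset.univ.filter fun j : Fin p => (j : ℕ) < p₀
  have hsmall : 12 * ∑ j ∈ A₁ \ A₀, c j ^ 2 ≤ η ^ 2 := by
    have h := (sum_sq_integral_mul_centered_le hdm (A₁ \ A₀)).trans hbound
    rwa [Finset.sum_congr rfl fun j hj => by
      rw [hcoef j (by simpa [A₀] using (Finset.mem_sdiff.1 hj).2)]] at h
  obtain ⟨k, hk⟩ := hmiss
  have hbig : τ ^ 2 ≤ ∑ j ∈ A₀ \ A₁, c j ^ 2 :=
    (hlarge k (by simpa [A₀] using (Finset.mem_sdiff.1 hk).1)).trans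
      (Finset.single_le_sum (f := fun j => c j ^ 2) (fun j _ => sq_nonneg _) hk)
  have hsplit : ∑ j ∈ A₀, c j ^ 2 - ∑ j ∈ A₁, c j ^ 2
      = ∑ j ∈ A₀ \ A₁, c j ^ 2 - ∑ j ∈ A₁ \ A₀, c j ^ 2 := by
    have h₀ := Finset.sum_inter_add_sum_sdiff A₀ A₁ fun j => c j ^ 2
    have h₁ := Finset.sum_inter_add_sum_sdiff A₁ A₀ fun j => c j ^ 2
    rw [Finset.inter_comm] at h₁
    linarith
  rw [hL, hL, iInf_integral_sub_affine_sq hfm, iInf_integral_sub_affine_sq hfm]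
  have hM : (p₀ : ℝ) ≤ M := by exact_mod_cast hp₀M
  have hη2 : 0 ≤ ((M : ℝ) - p₀) * η ^ 2 := mul_nonneg (sub_nonneg.2 hM) (sq_nonneg η)
  have hη1 := sq_nonneg η
  change _ ≤ _ - _ - 12 * ∑ j ∈ A₁, c j ^ 2 - (_ - _ - 12 * ∑ j ∈ A₀, c j ^ 2)
  linarith
end

section
/- Let f(x₁,x₂) = (x₁ − 1/2)(x₂ − 1/2) on [0,1]². Then for all continuous functions s₁, s₂ : [0,1] → ℝ, ∫_{[0,1]²}[f(x₁,x₂) − (s₁(x₁) + s₂(x₂))]² d(x₁,x₂) = ∫_{[0,1]²} f(x₁,x₂)² d(x₁,x₂) + ∫_{[0,1]²}(s₁(x₁) + s₂(x₂))² d(x₁,x₂) ≥ ∫_{[0,1]²} f(x₁,x₂)² d(x₁,x₂). In particular, the best additive approximation of f (the minimizer of the left-hand side over continuous s₁, s₂) is the zero function, so the nonparametric additive model fails to identify the active variables x₁ and x₂ of f. -/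
open MeasureTheory

theorem integral_sub_half_Icc : ∫ x in Set.Icc (0:ℝ) 1, (x - 1/2) = 0 := by
  rw [integral_Icc_eq_integral_Ioc, ← intervalIntegral.integral_of_le zero_le_one,
    intervalIntegral.integral_sub (by simp) (by simp)]
  norm_num

theorem continuousOn_add_prod {s t : Set ℝ} {a b : ℝ → ℝ} (ha : ContinuousOn a s)
    (hb : ContinuousOn b t) :
    ContinuousOn (fun x : ℝ × ℝ => a x.1 + b x.2) (s ×ˢ t) :=
  (ha.comp continuousOn_fst fun _ h => h.1).add (hb.comp continuousOn_snd fun _ h => h.2)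

/-- The product of centred coordinates is orthogonal to every additive function. -/
theorem integral_mul_additive_eq_zero {a b : ℝ → ℝ} (ha : ContinuousOn a (Set.Icc 0 1))
    (hb : ContinuousOn b (Set.Icc 0 1)) :
    ∫ x in Set.Icc (0:ℝ) 1 ×ˢ Set.Icc (0:ℝ) 1,
      (x.1 - 1/2) * (x.2 - 1/2) * (a x.1 + b x.2) = 0 := by
  have hK : IsCompact (Set.Icc (0:ℝ) 1 ×ˢ Set.Icc (0:ℝ) 1) := isCompact_Icc.prod isCompact_Icc
  have ha' : ContinuousOn (fun x : ℝ × ℝ => a x.1) (Set.Icc (0:ℝ) 1 ×ˢ Set.Icc (0:ℝ) 1) :=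
    ha.comp continuousOn_fst fun _ h => h.1
  have hb' : ContinuousOn (fun x : ℝ × ℝ => b x.2) (Set.Icc (0:ℝ) 1 ×ˢ Set.Icc (0:ℝ) 1) :=
    hb.comp continuousOn_snd fun _ h => h.2
  have hsplit : ∀ x : ℝ × ℝ, (x.1 - 1/2) * (x.2 - 1/2) * (a x.1 + b x.2) =
      ((x.1 - 1/2) * a x.1) * (x.2 - 1/2) + (x.1 - 1/2) * ((x.2 - 1/2) * b x.2) :=
    fun x => by ring
  simp_rw [hsplit]
  have hfa : IntegrableOn (fun x : ℝ × ℝ => ((x.1 - 1/2) * a x.1) * (x.2 - 1/2))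
      (Set.Icc (0:ℝ) 1 ×ˢ Set.Icc (0:ℝ) 1) :=
    ContinuousOn.integrableOn_compact hK
      ((ContinuousOn.mul (by fun_prop) ha').mul (by fun_prop))
  have hfb : IntegrableOn (fun x : ℝ × ℝ => (x.1 - 1/2) * ((x.2 - 1/2) * b x.2))
      (Set.Icc (0:ℝ) 1 ×ˢ Set.Icc (0:ℝ) 1) :=
    ContinuousOn.integrableOn_compact hK
      (ContinuousOn.mul (by fun_prop) (ContinuousOn.mul (by fun_prop) hb'))
  rw [integral_add hfa hfb, Measure.volume_eq_prod,
    setIntegral_prod_mul (fun u : ℝ => (u - 1/2) * a u) (fun v : ℝ => v - 1/2),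
    setIntegral_prod_mul (fun u : ℝ => u - 1/2) (fun v : ℝ => (v - 1/2) * b v),
    integral_sub_half_Icc]
  simp

/-- Section D of the Supplementary Materials: for `f(x₁,x₂) = (x₁−1/2)(x₂−1/2)` on `[0,1]²`
and any continuous `s₁, s₂ : [0,1] → ℝ`, the additive-approximation loss decomposes as
`∫(f−(s₁+s₂))² = ∫f² + ∫(s₁+s₂)² ≥ ∫f²`; in particular any minimizing additive
approximation `s₁(x₁)+s₂(x₂)` is identically zero on `[0,1]²`, so the nonparametric
additive model cannot identify the active variables of `f`. -/
theorem additive_model_fails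
    (f : ℝ × ℝ → ℝ) (hf : ∀ x, f x = (x.1 - 1/2) * (x.2 - 1/2))
    (sq : Set (ℝ × ℝ)) (hsq : sq = Set.Icc (0:ℝ) 1 ×ˢ Set.Icc (0:ℝ) 1)
    (s₁ s₂ : ℝ → ℝ)
    (hs₁ : ContinuousOn s₁ (Set.Icc 0 1)) (hs₂ : ContinuousOn s₂ (Set.Icc 0 1)) :
    ((∫ x in sq, (f x - (s₁ x.1 + s₂ x.2))^2) =
        (∫ x in sq, (f x)^2) + ∫ x in sq, (s₁ x.1 + s₂ x.2)^2) ∧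
    ((∫ x in sq, (f x)^2) ≤ ∫ x in sq, (f x - (s₁ x.1 + s₂ x.2))^2) ∧
    ((∀ t₁ t₂ : ℝ → ℝ, ContinuousOn t₁ (Set.Icc 0 1) → ContinuousOn t₂ (Set.Icc 0 1) →
        (∫ x in sq, (f x - (s₁ x.1 + s₂ x.2))^2) ≤ ∫ x in sq, (f x - (t₁ x.1 + t₂ x.2))^2) →
      ∀ x₁ ∈ Set.Icc (0:ℝ) 1, ∀ x₂ ∈ Set.Icc (0:ℝ) 1, s₁ x₁ + s₂ x₂ = 0) := by
  obtain rfl : f = fun x => (x.1 - 1/2) * (x.2 - 1/2) := funext hf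
  subst hsq
  have hK : IsCompact (Set.Icc (0:ℝ) 1 ×ˢ Set.Icc (0:ℝ) 1) := isCompact_Icc.prod isCompact_Icc
  have hg := continuousOn_add_prod hs₁ hs₂
  have hdecomp : (∫ x in Set.Icc (0:ℝ) 1 ×ˢ Set.Icc (0:ℝ) 1,
      ((x.1 - 1/2) * (x.2 - 1/2) - (s₁ x.1 + s₂ x.2))^2) =
      (∫ x in Set.Icc (0:ℝ) 1 ×ˢ Set.Icc (0:ℝ) 1, ((x.1 - 1/2) * (x.2 - 1/2))^2) +
        ∫ x in Set.Icc (0:ℝ) 1 ×ˢ Set.Icc (0:ℝ) 1, (s₁ x.1 + s₂ x.2)^2 := by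
    have hexp : ∀ x : ℝ × ℝ, ((x.1 - 1/2) * (x.2 - 1/2) - (s₁ x.1 + s₂ x.2))^2 =
        (((x.1 - 1/2) * (x.2 - 1/2))^2 + (s₁ x.1 + s₂ x.2)^2) -
          2 * ((x.1 - 1/2) * (x.2 - 1/2) * (s₁ x.1 + s₂ x.2)) := fun x => by ring
    have hf2 : IntegrableOn (fun x : ℝ × ℝ => ((x.1 - 1/2) * (x.2 - 1/2))^2)
        (Set.Icc (0:ℝ) 1 ×ˢ Set.Icc (0:ℝ) 1) :=
      ContinuousOn.integrableOn_compact hK (by fun_prop)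
    have hg2 : IntegrableOn (fun x : ℝ × ℝ => (s₁ x.1 + s₂ x.2)^2)
        (Set.Icc (0:ℝ) 1 ×ˢ Set.Icc (0:ℝ) 1) := (hg.pow 2).integrableOn_compact hK
    have hsum : IntegrableOn
        (fun x : ℝ × ℝ => ((x.1 - 1/2) * (x.2 - 1/2))^2 + (s₁ x.1 + s₂ x.2)^2)
        (Set.Icc (0:ℝ) 1 ×ˢ Set.Icc (0:ℝ) 1) := hf2.add hg2
    have hfg : IntegrableOn
        (fun x : ℝ × ℝ => 2 * ((x.1 - 1/2) * (x.2 - 1/2) * (s₁ x.1 + s₂ x.2)))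
        (Set.Icc (0:ℝ) 1 ×ˢ Set.Icc (0:ℝ) 1) :=
      ContinuousOn.integrableOn_compact hK
        (continuousOn_const.mul (ContinuousOn.mul (by fun_prop) hg))
    simp_rw [hexp]
    rw [integral_sub hsum hfg, integral_add hf2 hg2, integral_const_mul,
      integral_mul_additive_eq_zero hs₁ hs₂, mul_zero, sub_zero]
  have hnonneg : 0 ≤ ∫ x in Set.Icc (0:ℝ) 1 ×ˢ Set.Icc (0:ℝ) 1, (s₁ x.1 + s₂ x.2)^2 :=
    integral_nonneg fun x => sq_nonneg _
  refine ⟨hdecomp, by linarith, fun hmin x₁ hx₁ x₂ hx₂ => ?_⟩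
  have hle := hmin 0 0 continuousOn_const continuousOn_const
  simp only [Pi.zero_apply, add_zero, sub_zero] at hle
  have hzero : ∫ x in Set.Icc (0:ℝ) 1 ×ˢ Set.Icc (0:ℝ) 1, (s₁ x.1 + s₂ x.2)^2 = 0 := by
    linarith
  rw [integral_eq_zero_iff_of_nonneg (fun x => sq_nonneg _)
    ((hg.pow 2).integrableOn_compact hK)] at hzero
  have heq := Measure.eqOn_of_ae_eq hzero (hg.pow 2) continuousOn_const (by
    rw [interior_prod_eq, closure_prod_eq, interior_Icc, closure_Ioo zero_ne_one])
  exact pow_eq_zero_iff two_ne_zero |>.mp (heq (Set.mk_mem_prod hx₁ hx₂))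
end

section
/- Let f(x₁,x₂) = β₀ + β₁x₁ + β₂x₂ + β₃x₁² + β₄x₂² + β₅x₁x₂ on [0,1]², where β₀,…,β₅ ∈ ℝ. Then the unique minimizer (a₀, a₁, a₂) ∈ ℝ³ of ∫_{[0,1]²}[f(x₁,x₂) − (a₀ + a₁x₁ + a₂x₂)]² d(x₁,x₂) satisfies a₁ = β₁ + β₃ + β₅/2 and a₂ = β₂ + β₄ + β₅/2, and the minimum value of the integral equals β₃²/180 + β₄²/180 + β₅²/144. -/
open MeasureTheory

theorem integral_quartic_zero_one (p₀ p₁ p₂ p₃ p₄ : ℝ) :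
    ∫ t in (0:ℝ)..1, (p₀ + p₁ * t + p₂ * t ^ 2 + p₃ * t ^ 3 + p₄ * t ^ 4) =
      p₀ + p₁ / 2 + p₂ / 3 + p₃ / 4 + p₄ / 5 := by
  have hderiv (t : ℝ) : HasDerivAt
      (fun t : ℝ => p₀ * t + p₁ / 2 * t ^ 2 + p₂ / 3 * t ^ 3 + p₃ / 4 * t ^ 4 + p₄ / 5 * t ^ 5)
      (p₀ + p₁ * t + p₂ * t ^ 2 + p₃ * t ^ 3 + p₄ * t ^ 4) t := by
    refine HasDerivAt.congr_deriv ((((((hasDerivAt_id' t).const_mul p₀).add ((hasDerivAt_pow 2 t).const_mul (p₁ / 2))).add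
      ((hasDerivAt_pow 3 t).const_mul (p₂ / 3))).add
      ((hasDerivAt_pow 4 t).const_mul (p₃ / 4))).add
      ((hasDerivAt_pow 5 t).const_mul (p₄ / 5))) ?_
    push_cast
    ring
  rw [intervalIntegral.integral_eq_sub_of_hasDerivAt (fun t _ => hderiv t)
    (Continuous.intervalIntegrable (by fun_prop) _ _)]
  ring

theorem setIntegral_Icc_prod_Icc_eq_intervalIntegral {g : ℝ × ℝ → ℝ} (hg : Continuous g) :
    ∫ x in Set.Icc (0:ℝ) 1 ×ˢ Set.Icc (0:ℝ) 1, g x =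
      ∫ x in (0:ℝ)..1, ∫ y in (0:ℝ)..1, g (x, y) := by
  rw [Measure.volume_eq_prod, setIntegral_prod _
    (hg.continuousOn.integrableOn_compact (isCompact_Icc.prod isCompact_Icc))]
  simp only [intervalIntegral.integral_of_le zero_le_one, integral_Icc_eq_integral_Ioc]

theorem setIntegral_unitSquare_quadratic_sq (c₀ c₁ c₂ c₃ c₄ c₅ : ℝ) :
    ∫ x in Set.Icc (0:ℝ) 1 ×ˢ Set.Icc (0:ℝ) 1,
      (c₀ + c₁ * x.1 + c₂ * x.2 + c₃ * x.1 ^ 2 + c₄ * x.2 ^ 2 + c₅ * x.1 * x.2) ^ 2 =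
      c₃ ^ 2 / 180 + c₄ ^ 2 / 180 + c₅ ^ 2 / 144 + (c₁ + c₃ + c₅ / 2) ^ 2 / 12 +
        (c₂ + c₄ + c₅ / 2) ^ 2 / 12 +
        (c₀ + c₁ / 2 + c₂ / 2 + c₃ / 3 + c₄ / 3 + c₅ / 4) ^ 2 := by
  rw [setIntegral_Icc_prod_Icc_eq_intervalIntegral (by fun_prop)]
  have inner (x : ℝ) : ∫ y in (0:ℝ)..1,
      (c₀ + c₁ * x + c₂ * y + c₃ * x ^ 2 + c₄ * y ^ 2 + c₅ * x * y) ^ 2 =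
      (c₀ ^ 2 + c₀ * c₂ + (c₂ ^ 2 + 2 * c₀ * c₄) / 3 + c₂ * c₄ / 2 + c₄ ^ 2 / 5) +
      (2 * c₀ * c₁ + c₀ * c₅ + c₁ * c₂ + (2 * c₂ * c₅ + 2 * c₁ * c₄) / 3 + c₅ * c₄ / 2) * x +
      (c₁ ^ 2 + 2 * c₀ * c₃ + c₁ * c₅ + c₃ * c₂ + (c₅ ^ 2 + 2 * c₃ * c₄) / 3) * x ^ 2 +
      (2 * c₁ * c₃ + c₃ * c₅) * x ^ 3 + c₃ ^ 2 * x ^ 4 := by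
    have h := integral_quartic_zero_one ((c₀ + c₁ * x + c₃ * x ^ 2) ^ 2)
      (2 * (c₀ + c₁ * x + c₃ * x ^ 2) * (c₂ + c₅ * x))
      ((c₂ + c₅ * x) ^ 2 + 2 * (c₀ + c₁ * x + c₃ * x ^ 2) * c₄)
      (2 * (c₂ + c₅ * x) * c₄) (c₄ ^ 2)
    convert h using 1
    · congr 1
      ext y
      ring
    · ring
  simp only [inner, integral_quartic_zero_one]
  ring

/-- Table 1 (linear basis): for a quadratic function `f` on `[0,1]²`, the unique minimizer
`(a₀,a₁,a₂)` of the squared `L²` loss over affine functions `a₀ + a₁x₁ + a₂x₂` satisfies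
`a₁ = β₁ + β₃ + β₅/2`, `a₂ = β₂ + β₄ + β₅/2`, and the minimum loss equals
`β₃²/180 + β₄²/180 + β₅²/144`. -/
theorem quadratic_function_linear_bla (β₀ β₁ β₂ β₃ β₄ β₅ : ℝ)
    (f : ℝ × ℝ → ℝ)
    (hf : ∀ x, f x = β₀ + β₁ * x.1 + β₂ * x.2 + β₃ * x.1^2 + β₄ * x.2^2 + β₅ * x.1 * x.2)
    (G : ℝ → ℝ → ℝ → ℝ)
    (hG : ∀ a₀ a₁ a₂, G a₀ a₁ a₂ = ∫ x in Set.Icc (0:ℝ) 1 ×ˢ Set.Icc (0:ℝ) 1,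
      (f x - (a₀ + a₁ * x.1 + a₂ * x.2))^2) :
    ∃ a₀ a₁ a₂ : ℝ,
      (∀ b₀ b₁ b₂ : ℝ, (b₀, b₁, b₂) ≠ (a₀, a₁, a₂) → G a₀ a₁ a₂ < G b₀ b₁ b₂) ∧
      a₁ = β₁ + β₃ + β₅ / 2 ∧ a₂ = β₂ + β₄ + β₅ / 2 ∧
      G a₀ a₁ a₂ = β₃^2 / 180 + β₄^2 / 180 + β₅^2 / 144 := by
  have loss (b₀ b₁ b₂ : ℝ) : G b₀ b₁ b₂ =
      β₃ ^ 2 / 180 + β₄ ^ 2 / 180 + β₅ ^ 2 / 144 + (β₁ - b₁ + β₃ + β₅ / 2) ^ 2 / 12 +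
        (β₂ - b₂ + β₄ + β₅ / 2) ^ 2 / 12 +
        (β₀ - b₀ + (β₁ - b₁) / 2 + (β₂ - b₂) / 2 + β₃ / 3 + β₄ / 3 + β₅ / 4) ^ 2 := by
    rw [hG, ← setIntegral_unitSquare_quadratic_sq]
    congr 1
    ext x
    rw [hf]
    ring
  have min_eq : G (β₀ - β₃ / 6 - β₄ / 6 - β₅ / 4) (β₁ + β₃ + β₅ / 2) (β₂ + β₄ + β₅ / 2) =
      β₃ ^ 2 / 180 + β₄ ^ 2 / 180 + β₅ ^ 2 / 144 := by
    rw [loss]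
    ring
  refine ⟨_, _, _, fun b₀ b₁ b₂ hne => ?_, rfl, rfl, min_eq⟩
  rw [min_eq, loss]
  contrapose! hne
  have sq₁ := sq_nonneg (β₁ - b₁ + β₃ + β₅ / 2)
  have sq₂ := sq_nonneg (β₂ - b₂ + β₄ + β₅ / 2)
  have sq₀ := sq_nonneg (β₀ - b₀ + (β₁ - b₁) / 2 + (β₂ - b₂) / 2 + β₃ / 3 + β₄ / 3 + β₅ / 4)
  have h₁ : β₁ - b₁ + β₃ + β₅ / 2 = 0 := pow_eq_zero_iff two_ne_zero |>.mp (by linarith)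
  have h₂ : β₂ - b₂ + β₄ + β₅ / 2 = 0 := pow_eq_zero_iff two_ne_zero |>.mp (by linarith)
  have h₀ : β₀ - b₀ + (β₁ - b₁) / 2 + (β₂ - b₂) / 2 + β₃ / 3 + β₄ / 3 + β₅ / 4 = 0 :=
    pow_eq_zero_iff two_ne_zero |>.mp (by linarith)
  simp only [Prod.mk.injEq]
  refine ⟨?_, ?_, ?_⟩ <;> linarith
end

section
/- Let f(x₁,x₂) = β₀ + β₁x₁ + β₂x₂ + β₃x₁² + β₄x₂² + β₅x₁x₂ on [0,1]², where β₀,…,β₅ ∈ ℝ. Then the unique minimizer (c₀, c₁, c₂) ∈ ℝ³ of ∫_{[0,1]²}[f(x₁,x₂) − (c₀ + c₁x₁² + c₂x₂²)]² d(x₁,x₂) satisfies c₁ = 15β₁/16 + β₃ + 15β₅/32 and c₂ = 15β₂/16 + β₄ + 15β₅/32, and the minimum value of the integral equals β₁²/192 + β₂²/192 + 11β₅²/1152 + β₁β₅/192 + β₂β₅/192. -/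
open MeasureTheory

/-- The integral over the unit interval of a polynomial of degree at most four. -/
lemma setIntegral_Icc_quartic (p₀ p₁ p₂ p₃ p₄ : ℝ) :
    ∫ x in Set.Icc (0:ℝ) 1, (p₀ + p₁ * x + p₂ * x^2 + p₃ * x^3 + p₄ * x^4) =
      p₀ + p₁ / 2 + p₂ / 3 + p₃ / 4 + p₄ / 5 := by
  rw [integral_Icc_eq_integral_Ioc, ← intervalIntegral.integral_of_le zero_le_one,
    intervalIntegral.integral_eq_sub_of_hasDerivAt (f := fun x : ℝ =>
      p₀ * x + p₁ / 2 * x^2 + p₂ / 3 * x^3 + p₃ / 4 * x^4 + p₄ / 5 * x^5)]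
  · ring
  · intro x _
    have h := (((((hasDerivAt_id x).const_mul p₀).add
      ((hasDerivAt_pow 2 x).const_mul (p₁ / 2))).add
      ((hasDerivAt_pow 3 x).const_mul (p₂ / 3))).add
      ((hasDerivAt_pow 4 x).const_mul (p₃ / 4))).add
      ((hasDerivAt_pow 5 x).const_mul (p₄ / 5))
    refine h.congr_deriv ?_
    push_cast
    ring
  · exact Continuous.intervalIntegrable (by fun_prop) _ _

/-- The squared `L²` norm on the unit square of a quadratic polynomial in two variables. -/
lemma setIntegral_unitSquare_sq_quadratic (a b c d e g : ℝ) :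
    ∫ x in Set.Icc (0:ℝ) 1 ×ˢ Set.Icc (0:ℝ) 1,
      (a + b * x.1 + c * x.2 + d * x.1^2 + e * x.2^2 + g * x.1 * x.2)^2 =
      (a + b / 2 + c / 2 + d / 3 + e / 3 + g / 4)^2
        + (b^2 + c^2) / 12 + 4 * (d^2 + e^2) / 45 + 7 * g^2 / 144
        + (b * d + c * e) / 6 + (b + c) * g / 12 + (d + e) * g / 12 := by
  have hint : IntegrableOn (fun x : ℝ × ℝ =>
      (a + b * x.1 + c * x.2 + d * x.1^2 + e * x.2^2 + g * x.1 * x.2)^2)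
      (Set.Icc (0:ℝ) 1 ×ˢ Set.Icc (0:ℝ) 1) (volume.prod volume) :=
    ContinuousOn.integrableOn_compact (isCompact_Icc.prod isCompact_Icc)
      (Continuous.continuousOn (by fun_prop))
  rw [Measure.volume_eq_prod, setIntegral_prod _ hint]
  have hinner : ∀ x : ℝ, ∫ y in Set.Icc (0:ℝ) 1,
      (a + b * x + c * y + d * x^2 + e * y^2 + g * x * y)^2 =
      (a^2 + a * c + (c^2 + 2 * a * e) / 3 + c * e / 2 + e^2 / 5)
        + (2 * a * b + (a * g + b * c) + 2 * (c * g + b * e) / 3 + g * e / 2) * x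
        + (b^2 + 2 * a * d + (b * g + c * d) + (g^2 + 2 * d * e) / 3) * x^2
        + (2 * b * d + d * g) * x^3 + d^2 * x^4 := by
    intro x
    trans ∫ y in Set.Icc (0:ℝ) 1, ((a + b * x + d * x^2)^2
        + 2 * (a + b * x + d * x^2) * (c + g * x) * y
        + ((c + g * x)^2 + 2 * (a + b * x + d * x^2) * e) * y^2
        + 2 * (c + g * x) * e * y^3 + e^2 * y^4)
    · congr 1
      ext y
      ring
    · rw [setIntegral_Icc_quartic]
      ring
  simp only [hinner]
  rw [setIntegral_Icc_quartic]
  ring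

/-- Table 1 (quadratic basis): for a quadratic function `f` on `[0,1]²`, the unique
minimizer `(c₀,c₁,c₂)` of the squared `L²` loss over functions `c₀ + c₁x₁² + c₂x₂²`
satisfies `c₁ = 15β₁/16 + β₃ + 15β₅/32`, `c₂ = 15β₂/16 + β₄ + 15β₅/32`, and the minimum
loss equals `β₁²/192 + β₂²/192 + 11β₅²/1152 + β₁β₅/192 + β₂β₅/192`. -/
theorem quadratic_function_quadratic_bla (β₀ β₁ β₂ β₃ β₄ β₅ : ℝ)
    (f : ℝ × ℝ → ℝ)
    (hf : ∀ x, f x = β₀ + β₁ * x.1 + β₂ * x.2 + β₃ * x.1^2 + β₄ * x.2^2 + β₅ * x.1 * x.2)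
    (G : ℝ → ℝ → ℝ → ℝ)
    (hG : ∀ c₀ c₁ c₂, G c₀ c₁ c₂ = ∫ x in Set.Icc (0:ℝ) 1 ×ˢ Set.Icc (0:ℝ) 1,
      (f x - (c₀ + c₁ * x.1^2 + c₂ * x.2^2))^2) :
    ∃ c₀ c₁ c₂ : ℝ,
      (∀ d₀ d₁ d₂ : ℝ, (d₀, d₁, d₂) ≠ (c₀, c₁, c₂) → G c₀ c₁ c₂ < G d₀ d₁ d₂) ∧
      c₁ = 15 * β₁ / 16 + β₃ + 15 * β₅ / 32 ∧ c₂ = 15 * β₂ / 16 + β₄ + 15 * β₅ / 32 ∧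
      G c₀ c₁ c₂ = β₁^2 / 192 + β₂^2 / 192 + 11 * β₅^2 / 1152
        + β₁ * β₅ / 192 + β₂ * β₅ / 192 := by
  have hval : ∀ d₀ d₁ d₂ : ℝ, G d₀ d₁ d₂ =
      β₁^2 / 192 + β₂^2 / 192 + 11 * β₅^2 / 1152 + β₁ * β₅ / 192 + β₂ * β₅ / 192
        + ((d₀ - (β₀ + 3 * β₁ / 16 + 3 * β₂ / 16 - β₅ / 16))
          + ((d₁ - (15 * β₁ / 16 + β₃ + 15 * β₅ / 32))
            + (d₂ - (15 * β₂ / 16 + β₄ + 15 * β₅ / 32))) / 3)^2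
        + 4 / 45 * ((d₁ - (15 * β₁ / 16 + β₃ + 15 * β₅ / 32))^2
          + (d₂ - (15 * β₂ / 16 + β₄ + 15 * β₅ / 32))^2) := by
    intro d₀ d₁ d₂
    rw [hG]
    trans ∫ x in Set.Icc (0:ℝ) 1 ×ˢ Set.Icc (0:ℝ) 1,
      ((β₀ - d₀) + β₁ * x.1 + β₂ * x.2 + (β₃ - d₁) * x.1^2 + (β₄ - d₂) * x.2^2
        + β₅ * x.1 * x.2)^2
    · congr 1
      ext x
      rw [hf]
      ring
    · rw [setIntegral_unitSquare_sq_quadratic]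
      ring
  refine ⟨β₀ + 3 * β₁ / 16 + 3 * β₂ / 16 - β₅ / 16, 15 * β₁ / 16 + β₃ + 15 * β₅ / 32,
    15 * β₂ / 16 + β₄ + 15 * β₅ / 32, ?_, rfl, rfl, ?_⟩
  · intro d₀ d₁ d₂ hne
    rw [hval, hval d₀]
    generalize β₀ + 3 * β₁ / 16 + 3 * β₂ / 16 - β₅ / 16 = c₀ at *
    generalize 15 * β₁ / 16 + β₃ + 15 * β₅ / 32 = c₁ at *
    generalize 15 * β₂ / 16 + β₄ + 15 * β₅ / 32 = c₂ at *
    by_contra! hle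
    have hsq₀ := sq_nonneg (d₀ - c₀ + (d₁ - c₁ + (d₂ - c₂)) / 3)
    have hsq₁ := sq_nonneg (d₁ - c₁)
    have hsq₂ := sq_nonneg (d₂ - c₂)
    simp only [sub_self, add_zero, zero_div] at hle
    have h₁ : d₁ - c₁ = 0 := pow_eq_zero_iff two_ne_zero |>.mp (by linarith)
    have h₂ : d₂ - c₂ = 0 := pow_eq_zero_iff two_ne_zero |>.mp (by linarith)
    have h₀ : d₀ - c₀ + (d₁ - c₁ + (d₂ - c₂)) / 3 = 0 :=
      pow_eq_zero_iff two_ne_zero |>.mp (by linarith)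
    refine hne (Prod.ext ?_ (Prod.ext ?_ ?_)) <;> dsimp only <;> linarith
  · rw [hval]
    ring
end

section
/- For each n, let p_n ≥ 2 be an integer and let (x_{ij}), 1 ≤ i ≤ n, 1 ≤ j ≤ p_n, be independent random variables uniformly distributed on [0,1). Suppose log p_n = O(n^{γ₁₀}) for some γ₁₀ > 0, and let γ₀ > 0 satisfy γ₁₀ + 2γ₀ < 1. For each pair 1 ≤ j < k ≤ p_n, let δ_{2,n}(j,k) = sup_{(u,v) ∈ [0,1]²} |(1/n)∑_{i=1}^n 1{x_{ij} ≤ u, x_{ik} ≤ v} − uv| be the L∞ discrepancy of the two-dimensional point set {(x_{ij}, x_{ik}) : i = 1,…,n}. Then P(max_{1 ≤ j < k ≤ p_n} δ_{2,n}(j,k) ≤ n^{−γ₀}) → 1 as n → ∞. -/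
open MeasureTheory

theorem abs_sub_mul_le_of_grid {G : ℝ → ℝ → ℝ}
    (hG : ∀ u u' v v', u ≤ u' → v ≤ v' → G u v ≤ G u' v') {M : ℕ} (hM : 0 < M) {η : ℝ}
    (hgrid : ∀ a b : ℕ, a ≤ M → b ≤ M → |G (a / M) (b / M) - (a / M : ℝ) * (b / M)| ≤ η)
    {u v : ℝ} (hu : u ∈ Set.Icc (0 : ℝ) 1) (hv : v ∈ Set.Icc (0 : ℝ) 1) :
    |G u v - u * v| ≤ η + 2 / M := by
  have hM' : (0 : ℝ) < M := by exact_mod_cast hM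
  have key : ∀ w ∈ Set.Icc (0 : ℝ) 1, ∃ a b : ℕ, a ≤ M ∧ b ≤ M ∧ (a / M : ℝ) ≤ w ∧
      w ≤ (b / M : ℝ) ∧ w - 1 / M ≤ (a / M : ℝ) ∧ (b / M : ℝ) ≤ w + 1 / M := by
    intro w hw
    have hwM : 0 ≤ w * M := mul_nonneg hw.1 hM'.le
    have hwM' : w * M ≤ M := mul_le_of_le_one_left hM'.le hw.2
    refine ⟨⌊w * M⌋₊, ⌈w * M⌉₊, Nat.floor_le_of_le hwM', Nat.ceil_le.2 hwM', ?_, ?_, ?_, ?_⟩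
    · exact (div_le_iff₀ hM').2 (Nat.floor_le hwM)
    · exact (le_div_iff₀ hM').2 (Nat.le_ceil _)
    · rw [le_div_iff₀ hM', sub_mul, one_div_mul_cancel hM'.ne']
      exact (Nat.sub_one_lt_floor _).le
    · rw [div_le_iff₀ hM', add_mul, one_div_mul_cancel hM'.ne']
      exact (Nat.ceil_lt_add_one hwM).le
  obtain ⟨a, a', ha, ha', hau, hua, hau', hua'⟩ := key u hu
  obtain ⟨b, b', hb, hb', hbv, hvb, hbv', hvb'⟩ := key v hv
  have h1 := abs_le.1 (hgrid a b ha hb)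
  have h2 := abs_le.1 (hgrid a' b' ha' hb')
  have h3 := hG _ _ _ _ hau hbv
  have h4 := hG _ _ _ _ hua hvb
  have ha0 : (0 : ℝ) ≤ a / M := by positivity
  have hb0 : (0 : ℝ) ≤ b / M := by positivity
  have ha1 : (a' / M : ℝ) ≤ 1 := (div_le_one hM').2 (by exact_mod_cast ha')
  have hb1 : (b' / M : ℝ) ≤ 1 := (div_le_one hM').2 (by exact_mod_cast hb')
  have hd : (2 : ℝ) / M = 1 / M + 1 / M := by ring
  rw [hd]
  generalize (a / M : ℝ) = α at *
  generalize (b / M : ℝ) = β at *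
  generalize (a' / M : ℝ) = α' at *
  generalize (b' / M : ℝ) = β' at *
  have hd0 : (0 : ℝ) ≤ 1 / M := by positivity
  generalize (1 / M : ℝ) = d at *
  obtain ⟨hu0, hu1⟩ := hu
  obtain ⟨hv0, hv1⟩ := hv
  rw [abs_le]
  constructor
  · nlinarith [mul_le_mul_of_nonneg_left (sub_le_comm.1 hbv') hu0,
      mul_le_mul_of_nonneg_left (sub_le_comm.1 hau') hb0]
  · nlinarith [mul_le_mul_of_nonneg_left (sub_le_iff_le_add'.2 hvb') (hu0.trans hua),
      mul_le_mul_of_nonneg_left (sub_le_iff_le_add'.2 hua') hv0]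

open ProbabilityTheory in
theorem measureReal_le_abs_sum_indicator_sub_le {ι Ω : Type*} [Fintype ι] [MeasurableSpace Ω]
    {μ : Measure Ω} [IsProbabilityMeasure μ] {E : ι → Set Ω} (hE : ∀ i, MeasurableSet (E i))
    (hind : iIndepSet E μ) {q : ℝ} (hq : ∀ i, μ.real (E i) = q) {t : ℝ} (ht : 0 ≤ t) :
    μ.real {ω | t ≤ |∑ i, ((E i).indicator (fun _ => (1 : ℝ)) ω - q)|} ≤
      2 * Real.exp (-2 * t ^ 2 / Fintype.card ι) := by
  have hsub : ∀ i, HasSubgaussianMGF (fun ω => (E i).indicator (fun _ => (1 : ℝ)) ω - q)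
      ((‖(1 : ℝ) - 0‖₊ / 2) ^ 2) μ := by
    intro i
    have h := hasSubgaussianMGF_of_mem_Icc (μ := μ) (a := 0) (b := 1)
      (X := (E i).indicator (fun _ => (1 : ℝ)))
      (measurable_const.indicator (hE i)).aemeasurable
      (ae_of_all _ fun ω => by by_cases h : ω ∈ E i <;> simp [h])
    have hint : μ[(E i).indicator (fun _ => (1 : ℝ))] = q := by
      rw [integral_indicator_const _ (hE i), hq i]; simp
    rwa [hint] at h
  have hindep : iIndepFun (fun i ω => (E i).indicator (fun _ => (1 : ℝ)) ω - q) μ :=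
    (hind.iIndepFun_indicator (β := ℝ)).comp (fun _ x => x - q)
      (fun _ => measurable_id.sub_const q)
  have hsum := HasSubgaussianMGF.sum_of_iIndepFun hindep (s := Finset.univ)
    (fun i _ => hsub i)
  have hexp : -t ^ 2 / (2 * ((∑ _i : ι, (‖(1 : ℝ) - 0‖₊ / 2) ^ 2 : NNReal) : ℝ)) =
      -2 * t ^ 2 / Fintype.card ι := by
    simp
    ring
  have h1 := hsum.measure_ge_le ht
  have h2 := hsum.neg.measure_ge_le ht
  rw [hexp] at h1 h2
  calc _ ≤ μ.real ({ω | t ≤ ∑ i, ((E i).indicator (fun _ => (1 : ℝ)) ω - q)} ∪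
        {ω | t ≤ (-fun ω => ∑ i, ((E i).indicator (fun _ => (1 : ℝ)) ω - q)) ω}) :=
        measureReal_mono fun ω (hω : t ≤ |_|) => le_abs.1 hω
    _ ≤ _ := (measureReal_union_le _ _).trans (by linarith)

theorem pi_biInter_pair {ι κ α : Type*} [Fintype ι] [Fintype κ] [MeasurableSpace α]
    (ν : Measure α) [IsProbabilityMeasure ν] {j k : κ} (hjk : j ≠ k) (A B : Set α)
    (s : Finset ι) :
    (Measure.pi fun _ : ι × κ => ν) (⋂ i ∈ s, {ω | ω (i, j) ∈ A ∧ ω (i, k) ∈ B}) =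
      ∏ _i ∈ s, (ν A * ν B) := by
  classical
  have hset : (⋂ i ∈ s, {ω : ι × κ → α | ω (i, j) ∈ A ∧ ω (i, k) ∈ B}) =
      Set.univ.pi fun q : ι × κ => if q.1 ∈ s then
        (if q.2 = j then A else if q.2 = k then B else Set.univ) else Set.univ := by
    ext ω
    simp only [Set.mem_iInter, Set.mem_ite_univ_right, Set.mem_pi, Set.mem_univ, true_imp_iff,
      Set.mem_ofPred_eq, Prod.forall]
    refine forall_congr' fun i => ⟨fun h l hi => ?_, fun h hi => ⟨?_, ?_⟩⟩
    · split_ifs with h1 h2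
      · exact h1 ▸ (h hi).1
      · exact h2 ▸ (h hi).2
      · trivial
    · simpa using h j hi
    · simpa [hjk.symm] using h k hi
  rw [hset, Measure.pi_pi, Fintype.prod_prod_type, ← Finset.prod_subset s.subset_univ]
  · refine Finset.prod_congr rfl fun i hi => ?_
    rw [Fintype.prod_eq_mul j k hjk]
    · simp [hi, hjk.symm]
    · rintro l ⟨h1, h2⟩
      simp [hi, h1, h2]
  · intro i _ hi
    simp [hi]

theorem volume_restrict_Ico_Iic {u : ℝ} (hu : u ≤ 1) :
    volume.restrict (Set.Ico (0 : ℝ) 1) (Set.Iic u) = ENNReal.ofReal u := by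
  rw [Measure.restrict_congr_set Ico_ae_eq_Icc, Measure.restrict_apply measurableSet_Iic]
  have : Set.Iic u ∩ Set.Icc 0 1 = Set.Icc 0 u := by
    ext x
    simp only [Set.mem_inter_iff, Set.mem_Iic, Set.mem_Icc]
    exact ⟨fun h => ⟨h.2.1, h.1⟩, fun h => ⟨h.2, h.1, h.2.trans hu⟩⟩
  rw [this, Real.volume_Icc, sub_zero]

theorem tendsto_union_bound {p : ℕ → ℕ} (hp : ∀ n, 0 < p n) {a b C : ℝ} (hab : a < b)
    (hb : 0 < b) (hlogp : ∀ n : ℕ, 1 ≤ n → Real.log (p n) ≤ C * (n : ℝ) ^ a) :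
    Filter.Tendsto (fun n : ℕ => (p n : ℝ) ^ 2 * (4 * n + 1 : ℝ) ^ 2 *
      (2 * Real.exp (-((n : ℝ) ^ b) / 2))) Filter.atTop (nhds 0) := by
  have hlim : Filter.Tendsto (fun n : ℕ => 50 * (((n : ℝ) ^ b) ^ (2 / b) *
      Real.exp (-(1 / 4) * (n : ℝ) ^ b))) Filter.atTop (nhds 0) := by
    have h := ((tendsto_rpow_mul_exp_neg_mul_atTop_nhds_zero (2 / b) (1 / 4)
      (by norm_num)).comp ((tendsto_rpow_atTop hb).comp tendsto_natCast_atTop_atTop)).const_mul 50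
    simpa [Function.comp_def] using h
  have hlo : ∀ᶠ n : ℕ in Filter.atTop, 2 * (C * (n : ℝ) ^ a) ≤ 1 / 4 * (n : ℝ) ^ b := by
    filter_upwards [((tendsto_rpow_atTop (sub_pos.2 hab)).comp
      tendsto_natCast_atTop_atTop).eventually_ge_atTop (8 * C),
      Filter.eventually_gt_atTop 0] with n hn hn0
    have h := mul_le_mul_of_nonneg_right hn (show (0 : ℝ) ≤ (n : ℝ) ^ a by positivity)
    rw [Function.comp, ← Real.rpow_add (by exact_mod_cast hn0), sub_add_cancel] at h
    linarith
  refine squeeze_zero' (.of_forall fun n => by positivity) ?_ hlim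
  filter_upwards [hlo, Filter.eventually_ge_atTop 1] with n hn hn1
  have hn1' : (1 : ℝ) ≤ n := by exact_mod_cast hn1
  have hp0 : (0 : ℝ) < p n := by exact_mod_cast hp n
  have hpow : ((n : ℝ) ^ b) ^ (2 / b) = (n : ℝ) ^ 2 := by
    rw [← Real.rpow_mul (by positivity), mul_div_cancel₀ _ hb.ne', Real.rpow_two]
  have hpn : (p n : ℝ) ^ 2 ≤ Real.exp (1 / 4 * (n : ℝ) ^ b) := by
    rw [← Real.exp_log (pow_pos hp0 2), Real.log_pow]
    exact Real.exp_le_exp.2 (by push_cast; linarith [hlogp n hn1])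
  have h4 : (4 * n + 1 : ℝ) ^ 2 ≤ 25 * (n : ℝ) ^ 2 := by nlinarith
  calc _ ≤ Real.exp (1 / 4 * (n : ℝ) ^ b) * (25 * (n : ℝ) ^ 2) *
        (2 * Real.exp (-((n : ℝ) ^ b) / 2)) := by gcongr
    _ = 50 * ((n : ℝ) ^ 2 * (Real.exp (1 / 4 * (n : ℝ) ^ b) *
        Real.exp (-((n : ℝ) ^ b) / 2))) := by ring
    _ = _ := by rw [← Real.exp_add, hpow]; congr 4; ring

instance isProbabilityMeasure_restrict_Ico :
    IsProbabilityMeasure (volume.restrict (Set.Ico (0 : ℝ) 1)) :=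
  ⟨by simp⟩

theorem measureReal_le_abs_sum_indicator_pair_le {n : ℕ} {κ : Type*} [Fintype κ] {j k : κ}
    (hjk : j ≠ k) {u v : ℝ} (hu : u ∈ Set.Icc (0 : ℝ) 1) (hv : v ∈ Set.Icc (0 : ℝ) 1)
    {t : ℝ} (ht : 0 ≤ t) :
    (Measure.pi fun _ : Fin n × κ => volume.restrict (Set.Ico (0 : ℝ) 1)).real
      {ω | t ≤ |∑ i : Fin n, ((Set.Iic u ×ˢ Set.Iic v).indicator (fun _ => (1 : ℝ))
        (ω (i, j), ω (i, k)) - u * v)|} ≤ 2 * Real.exp (-2 * t ^ 2 / n) := by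
  set μ := Measure.pi fun _ : Fin n × κ => volume.restrict (Set.Ico (0 : ℝ) 1)
  let E : Fin n → Set (Fin n × κ → ℝ) := fun i =>
    {ω | ω (i, j) ∈ Set.Iic u ∧ ω (i, k) ∈ Set.Iic v}
  have hE : ∀ i, MeasurableSet (E i) := fun i =>
    (measurable_pi_apply (i, j) measurableSet_Iic).inter
      (measurable_pi_apply (i, k) measurableSet_Iic)
  have hμE : ∀ i, μ (E i) = ENNReal.ofReal u * ENNReal.ofReal v := fun i => by
    have h := pi_biInter_pair (volume.restrict (Set.Ico (0 : ℝ) 1)) hjk (Set.Iic u) (Set.Iic v)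
      {i}
    simpa [μ, E, volume_restrict_Ico_Iic hu.2, volume_restrict_Ico_Iic hv.2] using h
  have hind : ProbabilityTheory.iIndepSet E μ := by
    rw [ProbabilityTheory.iIndepSet_iff_meas_biInter hE]
    intro s
    simp_rw [hμE, ← volume_restrict_Ico_Iic hu.2, ← volume_restrict_Ico_Iic hv.2]
    exact pi_biInter_pair _ hjk _ _ s
  have hq : ∀ i, μ.real (E i) = u * v := fun i => by
    rw [measureReal_def, hμE, ENNReal.toReal_mul, ENNReal.toReal_ofReal hu.1,
      ENNReal.toReal_ofReal hv.1]
  have h := measureReal_le_abs_sum_indicator_sub_le hE hind hq ht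
  rwa [Fintype.card_fin] at h

theorem abs_mean_indicator_sub_mul_le_of_grid {n : ℕ} (hn : 0 < n) {x y : Fin n → ℝ} {ε : ℝ}
    (hε : 1 / (n : ℝ) ≤ ε)
    (hgrid : ∀ a b : Fin (4 * n + 1), |∑ i : Fin n,
      ((Set.Iic ((a : ℝ) / (4 * n : ℕ)) ×ˢ Set.Iic ((b : ℝ) / (4 * n : ℕ))).indicator
        (fun _ => (1 : ℝ)) (x i, y i) - (a : ℝ) / (4 * n : ℕ) * ((b : ℝ) / (4 * n : ℕ)))| <
        n * ε / 2)
    {u v : ℝ} (hu : u ∈ Set.Icc (0 : ℝ) 1) (hv : v ∈ Set.Icc (0 : ℝ) 1) :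
    |1 / (n : ℝ) * (∑ i : Fin n, (Set.Iic u ×ˢ Set.Iic v).indicator (fun _ => (1 : ℝ))
      (x i, y i)) - u * v| ≤ ε := by
  have hn' : (0 : ℝ) < n := by exact_mod_cast hn
  have h := abs_sub_mul_le_of_grid (η := ε / 2) (M := 4 * n)
    (G := fun u v => 1 / (n : ℝ) * (∑ i : Fin n, (Set.Iic u ×ˢ Set.Iic v).indicator
      (fun _ => (1 : ℝ)) (x i, y i))) ?_ (by omega) ?_ hu hv
  · refine h.trans ?_
    have : (2 : ℝ) / (4 * n : ℕ) = 1 / n / 2 := by push_cast; field_simp; norm_num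
    linarith
  · intro u u' v v' huu hvv
    refine mul_le_mul_of_nonneg_left (Finset.sum_le_sum fun i _ => ?_) (by positivity)
    exact Set.indicator_le_indicator_of_subset
      (Set.prod_mono (Set.Iic_subset_Iic.2 huu) (Set.Iic_subset_Iic.2 hvv))
      (fun _ => zero_le_one) _
  · intro a b ha hb
    have h := hgrid ⟨a, by omega⟩ ⟨b, by omega⟩
    rw [Finset.sum_sub_distrib, Finset.sum_const, Finset.card_univ, Fintype.card_fin,
      nsmul_eq_mul] at h
    set c := (a : ℝ) / (4 * n : ℕ) * ((b : ℝ) / (4 * n : ℕ))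
    rw [show c = 1 / (n : ℝ) * (n * c) by field_simp, ← mul_sub, abs_mul,
      abs_of_pos (one_div_pos.2 hn'), one_div, inv_mul_le_iff₀ hn', ← mul_div_assoc]
    exact h.le

/-- Inequality (A.28): for a triangular array of i.i.d. `U[0,1)` variables
`(x_{ij})_{1≤i≤n, 1≤j≤p_n}` with `log p_n = O(n^{γ₁₀})` and `γ₁₀ + 2γ₀ < 1`, the maximum
over all coordinate pairs `j < k` of the two-dimensional `L∞` discrepancy of
`{(x_{ij}, x_{ik}) : i ≤ n}` is at most `n^{−γ₀}` with probability tending to one. -/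
theorem pairwise_discrepancy_random_sampling (p : ℕ → ℕ) (hp : ∀ n, 2 ≤ p n)
    (γten γzero : ℝ) (hγten : 0 < γten) (hγzero : 0 < γzero)
    (hlt : γten + 2 * γzero < 1)
    (C : ℝ) (hlogp : ∀ n : ℕ, 1 ≤ n → Real.log (p n) ≤ C * (n:ℝ) ^ γten)
    (μ : (n : ℕ) → Measure (Fin n × Fin (p n) → ℝ))
    (hμ : ∀ n, μ n = Measure.pi fun _ : Fin n × Fin (p n) =>
      volume.restrict (Set.Ico (0:ℝ) 1))
    (δ : (n : ℕ) → (Fin n × Fin (p n) → ℝ) → Fin (p n) → Fin (p n) → ℝ)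
    (hδ : ∀ n ω j k, δ n ω j k =
      ⨆ uv : (Set.Icc (0:ℝ) 1 ×ˢ Set.Icc (0:ℝ) 1 : Set (ℝ × ℝ)),
        |(1/(n:ℝ)) * (∑ i : Fin n,
            Set.indicator (Set.Iic (uv : ℝ × ℝ).1 ×ˢ Set.Iic (uv : ℝ × ℝ).2)
              (fun _ => (1:ℝ)) (ω (i, j), ω (i, k)))
          - (uv : ℝ × ℝ).1 * (uv : ℝ × ℝ).2|) :
    Filter.Tendsto
      (fun n => μ n {ω | ∀ j k : Fin (p n), j < k → δ n ω j k ≤ (n:ℝ) ^ (-γzero)})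
      Filter.atTop (nhds 1) := by
  have hb : 0 < 1 - 2 * γzero := by linarith
  have hlim := ENNReal.tendsto_ofReal (tendsto_union_bound (fun n => zero_lt_two.trans_le (hp n))
    (show γten < 1 - 2 * γzero by linarith) hb hlogp)
  rw [ENNReal.ofReal_zero] at hlim
  have hlim' := ENNReal.Tendsto.sub (tendsto_const_nhds (x := (1 : ENNReal))) hlim
    (.inl ENNReal.one_ne_top)
  rw [tsub_zero] at hlim'
  have hprob : ∀ n, IsProbabilityMeasure (μ n) := fun n => by rw [hμ]; infer_instance
  refine tendsto_of_tendsto_of_tendsto_of_le_of_le' hlim' tendsto_const_nhds ?_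
    (.of_forall fun n => prob_le_one)
  filter_upwards [Filter.eventually_ge_atTop 1] with n hn
  have hn1 : (1 : ℝ) ≤ n := by exact_mod_cast hn
  have hn0 : (0 : ℝ) < n := by linarith
  set ε : ℝ := (n : ℝ) ^ (-γzero) with hε
  have hε0 : 0 < ε := by positivity
  have hεn : 1 / (n : ℝ) ≤ ε := by
    rw [one_div, ← Real.rpow_neg_one]
    exact Real.rpow_le_rpow_of_exponent_le hn1 (by linarith)
  let bad : (Fin (p n) × Fin (p n)) × (Fin (4 * n + 1) × Fin (4 * n + 1)) →
      Set (Fin n × Fin (p n) → ℝ) := fun q => {ω | q.1.1 < q.1.2 ∧ n * ε / 2 ≤ |∑ i : Fin n,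
        ((Set.Iic ((q.2.1 : ℝ) / (4 * n : ℕ)) ×ˢ Set.Iic ((q.2.2 : ℝ) / (4 * n : ℕ))).indicator
          (fun _ => (1 : ℝ)) (ω (i, q.1.1), ω (i, q.1.2)) -
          (q.2.1 : ℝ) / (4 * n : ℕ) * ((q.2.2 : ℝ) / (4 * n : ℕ)))|}
  have hgridmem : ∀ a : Fin (4 * n + 1), (a : ℝ) / (4 * n : ℕ) ∈ Set.Icc (0 : ℝ) 1 := fun a =>
    ⟨by positivity, div_le_one_of_le₀ (by exact_mod_cast Nat.lt_succ_iff.1 a.2) (by positivity)⟩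
  have hexp : -2 * (n * ε / 2) ^ 2 / n = -((n : ℝ) ^ (1 - 2 * γzero)) / 2 := by
    have hsq : (n : ℝ) ^ (1 - 2 * γzero) = n * ε ^ 2 := by
      rw [hε, ← Real.rpow_natCast, ← Real.rpow_mul hn0.le, sub_eq_add_neg,
        Real.rpow_add hn0, Real.rpow_one]
      congr 2
      push_cast
      ring
    rw [hsq]
    field_simp
  have hbad : ∀ q, μ n (bad q) ≤
      ENNReal.ofReal (2 * Real.exp (-((n : ℝ) ^ (1 - 2 * γzero)) / 2)) := by
    intro q
    by_cases hq : q.1.1 < q.1.2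
    · have h := measureReal_le_abs_sum_indicator_pair_le (n := n) hq.ne (hgridmem q.2.1)
        (hgridmem q.2.2) (t := n * ε / 2) (by positivity)
      rw [← hμ n, hexp] at h
      refine (measure_mono fun ω hω => hω.2).trans ?_
      exact (ENNReal.le_ofReal_iff_toReal_le (measure_ne_top _ _) (by positivity)).2 h
    · simp [bad, hq]
  have hunion : μ n (⋃ q, bad q) ≤ ENNReal.ofReal ((p n : ℝ) ^ 2 * (4 * n + 1 : ℝ) ^ 2 *
      (2 * Real.exp (-((n : ℝ) ^ (1 - 2 * γzero)) / 2))) := by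
    refine (measure_iUnion_fintype_le _ _).trans ((Finset.sum_le_sum fun q _ => hbad q).trans ?_)
    rw [Finset.sum_const, ← ENNReal.ofReal_nsmul, nsmul_eq_mul]
    refine ENNReal.ofReal_le_ofReal (le_of_eq ?_)
    simp only [Finset.card_univ, Fintype.card_prod, Fintype.card_fin]
    push_cast
    ring
  rw [tsub_le_iff_left]
  refine le_trans ?_ (add_le_add_left hunion _)
  rw [← measure_univ (μ := μ n)]
  refine (measure_mono fun ω _ => ?_).trans (measure_union_le _ _)
  by_cases hω : ω ∈ ⋃ q, bad q
  · exact .inl hω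
  · refine .inr fun j k hjk => ?_
    rw [hδ]
    refine Real.iSup_le (fun uv => ?_) hε0.le
    refine abs_mean_indicator_sub_mul_le_of_grid hn hεn (fun a b => ?_) uv.2.1 uv.2.2
    by_contra! h
    exact hω (Set.mem_iUnion.2 ⟨((j, k), (a, b)), hjk, h⟩)
end
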